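/- Let f ∈ C^∞(ℝ) with f'(±1)=0, f''(±1)>0, and ∫_{-1}^u f' = ∫_1^u f' > 0 for all u ∈ (-1,1). Then the boundary value problem -w'' + f'(w) = 0 on ℝ with w(0)=0 and lim_{z→±∞} w(z) = ±1 has exactly one solution θ₀ ∈ C²(ℝ); moreover θ₀ is smooth, θ₀' > 0, and for every k ∈ ℕ₀ and every α ∈ (0, min{√(f''(1)), √(f''(-1))}) one has D_z^k(θ₀(z) ∓ 1) = O(e^{-α|z|}) as z → ±∞. -/

import Mathlib

open Real Filter MeasureTheory intervalIntegral

/-- `θ` is a `C²` solution of the optimal-profile boundary value problem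
`-w'' + f'(w) = 0`, `w 0 = 0`, `w (±∞) = ±1`. -/
def IsOptimalProfile (f θ : ℝ → ℝ) : Prop :=
  ContDiff ℝ 2 θ ∧ (∀ z : ℝ, -iteratedDeriv 2 θ z + deriv f (θ z) = 0) ∧ θ 0 = 0 ∧
    Tendsto θ atTop (nhds 1) ∧ Tendsto θ atBot (nhds (-1))

theorem abs_sub_le_mul_abs_sub_of_contDiff {ψ : ℝ → ℝ} (hψ : ContDiff ℝ 1 ψ) (R : ℝ) :
    ∃ M, 0 ≤ M ∧ ∀ u ∈ Set.Icc (-R) R, ∀ v ∈ Set.Icc (-R) R, |ψ u - ψ v| ≤ M * |u - v| := by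
  obtain ⟨M, hM⟩ := (isCompact_Icc (a := -R) (b := R)).exists_bound_of_continuousOn
    (hψ.continuous_deriv le_rfl).continuousOn
  refine ⟨max M 0, le_max_right _ _, fun u hu v hv => ?_⟩
  exact (convex_Icc (-R) R).norm_image_sub_le_of_norm_deriv_le
    (fun x _ => (hψ.differentiable (by norm_num)) x)
    (fun x hx => (hM x hx).trans (le_max_left _ _)) hv hu

theorem abs_sub_le_mul_sq_of_deriv_eq_zero {f : ℝ → ℝ} (hf : ContDiff ℝ 2 f) {a : ℝ}
    (ha : deriv f a = 0) {R : ℝ} (haR : a ∈ Set.Icc (-R) R) :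
    ∃ M, 0 ≤ M ∧ ∀ u ∈ Set.Icc (-R) R, |f u - f a| ≤ M * (u - a) ^ 2 := by
  have hf' : ContDiff ℝ 1 (deriv f) :=
    ContDiff.deriv' (n := 1) (by simpa [one_add_one_eq_two] using hf)
  obtain ⟨M, hM0, hM⟩ := abs_sub_le_mul_abs_sub_of_contDiff hf' R
  refine ⟨M, hM0, fun u hu => ?_⟩
  have hsub : Set.uIcc a u ⊆ Set.Icc (-R) R := Set.uIcc_subset_Icc haR hu
  have h := (convex_uIcc a u).norm_image_sub_le_of_norm_deriv_le (f := f) (C := M * |u - a|)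
    (fun x _ => (hf.differentiable (by norm_num)) x)
    (fun x hx => by
      have := hM x (hsub hx) a haR
      rw [ha, sub_zero] at this
      exact this.trans (mul_le_mul_of_nonneg_left (Set.abs_sub_left_of_mem_uIcc hx) hM0))
    Set.left_mem_uIcc Set.right_mem_uIcc
  rw [Real.norm_eq_abs, Real.norm_eq_abs, mul_assoc, abs_mul_abs_self, ← sq] at h
  exact h

theorem ne_zero_of_abs_deriv_le_mul_abs {y y' : ℝ → ℝ} {K : ℝ} (hy : ∀ z, HasDerivAt y (y' z) z)
    (hK : ∀ z, |y' z| ≤ K * |y z|) (h0 : y 0 ≠ 0) (z : ℝ) : y z ≠ 0 := by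
  have hprod : ∀ z, |y z * y' z| ≤ K * y z ^ 2 := fun z => by
    rw [abs_mul, ← sq_abs (y z)]
    nlinarith [hK z, abs_nonneg (y z)]
  have hder : ∀ c z, HasDerivAt (fun z => y z ^ 2 * exp (c * z))
      ((2 * (y z * y' z) + c * y z ^ 2) * exp (c * z)) z := fun c z => by
    refine (((hy z).pow 2).mul (((hasDerivAt_id' z).const_mul c).exp)).congr_deriv ?_
    simp only [Pi.pow_apply, Nat.cast_ofNat]
    ring
  intro hz
  rcases le_total 0 z with h | h
  · have hmono : Monotone (fun z => y z ^ 2 * exp (2 * K * z)) :=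
      monotone_of_hasDerivAt_nonneg (hder (2 * K)) fun z =>
        mul_nonneg (by linarith [neg_abs_le (y z * y' z), hprod z]) (exp_pos _).le
    have := hmono h
    simp [hz] at this
    exact h0 this
  · have hanti : Antitone (fun z => y z ^ 2 * exp (-(2 * K) * z)) :=
      antitone_of_hasDerivAt_nonpos (hder (-(2 * K))) fun z =>
        mul_nonpos_of_nonpos_of_nonneg (by linarith [le_abs_self (y z * y' z), hprod z])
          (exp_pos _).le
    have := hanti h
    simp [hz] at this
    exact h0 this

theorem exists_le_mul_exp_of_hasDerivAt_le {y y' : ℝ → ℝ} {α : ℝ}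
    (hy : ∀ z, HasDerivAt y (y' z) z) (h : ∀ᶠ z in atTop, y' z ≤ -α * y z) :
    ∃ C, ∀ z, 0 ≤ z → y z ≤ C * exp (-α * z) := by
  obtain ⟨Z, hZ⟩ := eventually_atTop.1 h
  set p : ℝ → ℝ := fun z => y z * exp (α * z) with hp
  have hder : ∀ z, HasDerivAt p ((y' z + α * y z) * exp (α * z)) z := fun z => by
    refine ((hy z).mul (((hasDerivAt_id' z).const_mul α).exp)).congr_deriv ?_
    ring
  have hcont : Continuous p := continuous_iff_continuousAt.2 fun z => (hder z).continuousAt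
  have hanti : AntitoneOn p (Set.Ici Z) :=
    antitoneOn_of_deriv_nonpos (convex_Ici Z) hcont.continuousOn
      (fun z _ => (hder z).differentiableAt.differentiableWithinAt) fun z hz => by
        rw [(hder z).deriv]
        rw [interior_Ici] at hz
        exact mul_nonpos_of_nonpos_of_nonneg (by linarith [hZ z (le_of_lt hz)]) (exp_pos _).le
  obtain ⟨C, hC⟩ := (isCompact_Icc (a := 0) (b := max Z 0)).exists_bound_of_continuousOn
    hcont.continuousOn
  refine ⟨C, fun z hz => ?_⟩
  have hpz : p z ≤ C := by
    rcases le_total z (max Z 0) with hle | hle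
    · exact (le_abs_self _).trans (hC z ⟨hz, hle⟩)
    · exact (hanti (le_max_left Z 0) ((le_max_left Z 0).trans hle) hle).trans
        ((le_abs_self _).trans (hC _ ⟨le_max_right _ _, le_rfl⟩))
  calc y z = p z * exp (-α * z) := by
        rw [hp, mul_assoc, ← exp_add]; simp
    _ ≤ C * exp (-α * z) := mul_le_mul_of_nonneg_right hpz (exp_pos _).le

theorem exists_primitive_inv_surjective {g : ℝ → ℝ} (hg : Continuous g)
    (hpos : ∀ u ∈ Set.Ioo (-1 : ℝ) 1, 0 < g u) {K : ℝ} (hK : 0 < K)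
    (hr : ∀ u ∈ Set.Ioo (-1 : ℝ) 1, g u ≤ K * (1 - u))
    (hl : ∀ u ∈ Set.Ioo (-1 : ℝ) 1, g u ≤ K * (1 + u)) :
    ∃ G : ℝ → ℝ, (∀ u ∈ Set.Ioo (-1 : ℝ) 1, HasDerivAt G (g u)⁻¹ u) ∧ G 0 = 0 ∧
      ∀ z, ∃ u ∈ Set.Ioo (-1 : ℝ) 1, G u = z := by
  have h0 : (0 : ℝ) ∈ Set.Ioo (-1 : ℝ) 1 := by norm_num
  have hinv : ContinuousOn (fun u => (g u)⁻¹) (Set.Ioo (-1 : ℝ) 1) :=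
    hg.continuousOn.inv₀ fun u hu => (hpos u hu).ne'
  set G : ℝ → ℝ := fun u => ∫ x in (0 : ℝ)..u, (g x)⁻¹ with hG
  have hderiv : ∀ u ∈ Set.Ioo (-1 : ℝ) 1, HasDerivAt G (g u)⁻¹ u := fun u hu =>
    integral_hasDerivAt_right
      ((hinv.mono (Set.OrdConnected.uIcc_subset Set.ordConnected_Ioo h0 hu)).intervalIntegrable)
      (hinv.stronglyMeasurableAtFilter isOpen_Ioo u hu) (hinv.continuousAt (isOpen_Ioo.mem_nhds hu))
  have hG0 : G 0 = 0 := by simp [hG]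
  have hGc : ContinuousOn G (Set.Ioo (-1) 1) := fun u hu =>
    (hderiv u hu).continuousAt.continuousWithinAt
  have hright : MonotoneOn (fun u => K * G u + log (1 - u)) (Set.Ioo (-1) 1) := by
    have hd : ∀ u ∈ Set.Ioo (-1 : ℝ) 1,
        HasDerivAt (fun u => K * G u + log (1 - u)) (K * (g u)⁻¹ + -1 / (1 - u)) u := fun u hu =>
      ((hderiv u hu).const_mul K).add
        (((hasDerivAt_id' u).const_sub 1).log (by linarith [hu.2]))
    refine monotoneOn_of_deriv_nonneg (convex_Ioo _ _)
      (fun u hu => (hd u hu).continuousAt.continuousWithinAt)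
      (fun u hu => (hd u (interior_subset hu)).differentiableAt.differentiableWithinAt)
      fun u hu => ?_
    have hu' := interior_subset hu
    rw [(hd u hu').deriv, ← div_eq_mul_inv, neg_div, ← sub_eq_add_neg, sub_nonneg,
      div_le_div_iff₀ (by linarith [hu'.2]) (hpos u hu')]
    linarith [hr u hu']
  have hleft : MonotoneOn (fun u => K * G u - log (1 + u)) (Set.Ioo (-1) 1) := by
    have hd : ∀ u ∈ Set.Ioo (-1 : ℝ) 1,
        HasDerivAt (fun u => K * G u - log (1 + u)) (K * (g u)⁻¹ - 1 / (1 + u)) u := fun u hu =>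
      ((hderiv u hu).const_mul K).sub
        (((hasDerivAt_id' u).const_add 1).log (by linarith [hu.1]))
    refine monotoneOn_of_deriv_nonneg (convex_Ioo _ _)
      (fun u hu => (hd u hu).continuousAt.continuousWithinAt)
      (fun u hu => (hd u (interior_subset hu)).differentiableAt.differentiableWithinAt)
      fun u hu => ?_
    have hu' := interior_subset hu
    rw [(hd u hu').deriv, ← div_eq_mul_inv, sub_nonneg,
      div_le_div_iff₀ (by linarith [hu'.1]) (hpos u hu')]
    linarith [hl u hu']
  refine ⟨G, hderiv, hG0, fun z => ?_⟩
  have he0 : 0 < exp (-(K * |z|)) := exp_pos _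
  have he1 : exp (-(K * |z|)) ≤ 1 := exp_le_one_iff.2 (by nlinarith [abs_nonneg z])
  have hu1 : 1 - exp (-(K * |z|)) ∈ Set.Ioo (-1 : ℝ) 1 := ⟨by linarith, by linarith⟩
  have hu2 : exp (-(K * |z|)) - 1 ∈ Set.Ioo (-1 : ℝ) 1 := ⟨by linarith, by linarith⟩
  have h1 := hright h0 hu1 (by linarith)
  have h2 := hleft hu2 h0 (by linarith)
  simp only [hG0, sub_sub_cancel, log_exp, mul_zero, sub_zero, log_one, add_zero,
    add_sub_cancel] at h1 h2
  refine isPreconnected_Ioo.intermediate_value hu2 hu1 hGc ⟨?_, ?_⟩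
  · refine le_trans ?_ (neg_abs_le z)
    nlinarith
  · refine (le_abs_self z).trans ?_
    nlinarith

theorem exists_unique_heteroclinic {g : ℝ → ℝ} (hg : Continuous g)
    (hpos : ∀ u ∈ Set.Ioo (-1 : ℝ) 1, 0 < g u) {K : ℝ} (hK : 0 < K)
    (hr : ∀ u ∈ Set.Ioo (-1 : ℝ) 1, g u ≤ K * (1 - u))
    (hl : ∀ u ∈ Set.Ioo (-1 : ℝ) 1, g u ≤ K * (1 + u)) :
    ∃ θ : ℝ → ℝ, (∀ z, θ z ∈ Set.Ioo (-1 : ℝ) 1) ∧ (∀ z, HasDerivAt θ (g (θ z)) z) ∧ θ 0 = 0 ∧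
      Tendsto θ atTop (nhds 1) ∧ Tendsto θ atBot (nhds (-1)) ∧
      ∀ w : ℝ → ℝ, (∀ z, w z ∈ Set.Ioo (-1 : ℝ) 1) → (∀ z, HasDerivAt w (g (w z)) z) →
        w 0 = 0 → w = θ := by
  obtain ⟨G, hG, hG0, hsurj⟩ := exists_primitive_inv_surjective hg hpos hK hr hl
  have h0 : (0 : ℝ) ∈ Set.Ioo (-1 : ℝ) 1 := by norm_num
  have hmono : StrictMonoOn G (Set.Ioo (-1) 1) := by
    refine strictMonoOn_of_deriv_pos (convex_Ioo _ _)
      (fun u hu => (hG u hu).continuousAt.continuousWithinAt) fun u hu => ?_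
    rw [(hG u (interior_subset hu)).deriv]
    exact inv_pos.2 (hpos u (interior_subset hu))
  choose θ hθ hGθ using hsurj
  have hθG : ∀ u ∈ Set.Ioo (-1 : ℝ) 1, θ (G u) = u := fun u hu =>
    hmono.injOn (hθ _) hu (hGθ _)
  have hθmono : StrictMono θ := fun a b hab =>
    (hmono.lt_iff_lt (hθ a) (hθ b)).1 (by rwa [hGθ, hGθ])
  have hrange : Set.range θ = Set.Ioo (-1) 1 :=
    Set.Subset.antisymm (Set.range_subset_iff.2 hθ) fun u hu => ⟨G u, hθG u hu⟩
  have hcont : ∀ z, ContinuousAt θ z := fun z =>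
    (hθmono.strictMonoOn Set.univ).continuousAt_of_image_mem_nhds univ_mem <| by
      rw [Set.image_univ, hrange]
      exact isOpen_Ioo.mem_nhds (hθ z)
  refine ⟨θ, hθ, fun z => ?_, ?_, ?_, ?_, fun w hw hw' hw0 => ?_⟩
  · have := HasDerivAt.of_local_left_inverse (hcont z) (hG _ (hθ z))
      (inv_ne_zero (hpos _ (hθ z)).ne') (Eventually.of_forall hGθ)
    rwa [inv_inv] at this
  · have := hθG 0 h0
    rwa [hG0] at this
  · refine tendsto_atTop_isLUB hθmono.monotone ?_
    rw [hrange]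
    exact isLUB_Ioo (by norm_num)
  · refine tendsto_atBot_isGLB hθmono.monotone ?_
    rw [hrange]
    exact isGLB_Ioo (by norm_num)
  · have hd : ∀ z, HasDerivAt (fun z => G (w z) - z) 0 z := fun z => by
      refine (((hG _ (hw z)).comp z (hw' z)).sub (hasDerivAt_id' z)).congr_deriv ?_
      rw [inv_mul_cancel₀ (hpos _ (hw z)).ne', sub_self]
    funext z
    have hc := is_const_of_deriv_eq_zero (fun z => (hd z).differentiableAt)
      (fun z => (hd z).deriv) z 0
    simp only [hw0, hG0, sub_zero] at hc
    rw [← hθG _ (hw z), sub_eq_zero.1 hc]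

theorem deriv_sq_eq_of_isOptimalProfile {f θ : ℝ → ℝ} (hf : ContDiff ℝ 2 f)
    (hθ : IsOptimalProfile f θ) (z : ℝ) : deriv θ z ^ 2 = 2 * (f (θ z) - f 1) := by
  obtain ⟨hC, hode, -, htop, -⟩ := hθ
  have hd : ∀ z, HasDerivAt θ (deriv θ z) z := fun z =>
    ((hC.differentiable (by norm_num)) z).hasDerivAt
  have hC1 : ContDiff ℝ 1 (deriv θ) :=
    ContDiff.deriv' (n := 1) (by simpa [one_add_one_eq_two] using hC)
  have hdd : ∀ z, HasDerivAt (deriv θ) (deriv f (θ z)) z := fun z => by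
    have h := hode z
    rw [iteratedDeriv_succ, iteratedDeriv_one] at h
    rw [← neg_add_eq_zero.1 h]
    exact ((hC1.differentiable (by norm_num)) z).hasDerivAt
  have hfd : ∀ u, HasDerivAt f (deriv f u) u := fun u =>
    ((hf.differentiable (by norm_num)) u).hasDerivAt
  have hE : ∀ z, HasDerivAt (fun z => deriv θ z ^ 2 - 2 * (f (θ z) - f 1)) 0 z := fun z => by
    refine (((hdd z).pow 2).sub
      ((((hfd (θ z)).comp z (hd z)).sub_const (f 1)).const_mul 2)).congr_deriv ?_
    simp only [Nat.cast_ofNat]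
    ring
  have hconst : ∀ a b, deriv θ a ^ 2 - 2 * (f (θ a) - f 1) = deriv θ b ^ 2 - 2 * (f (θ b) - f 1) :=
    is_const_of_deriv_eq_zero (fun z => (hE z).differentiableAt) (fun z => (hE z).deriv)
  have hmvt : ∀ n : ℕ, ∃ ξ ∈ Set.Ioo (n : ℝ) (n + 1), deriv θ ξ = θ (n + 1) - θ n := fun n => by
    obtain ⟨ξ, hξ, h⟩ := exists_hasDerivAt_eq_slope θ (deriv θ) (lt_add_one (n : ℝ))
      hC.continuous.continuousOn fun x _ => hd x
    refine ⟨ξ, hξ, ?_⟩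
    rw [h, add_sub_cancel_left, div_one]
  choose ξ hξ hξd using hmvt
  have hn : Tendsto (fun n : ℕ => (n : ℝ)) atTop atTop := tendsto_natCast_atTop_atTop
  have hξtop : Tendsto ξ atTop atTop := tendsto_atTop_mono (fun n => (hξ n).1.le) hn
  have hlim1 : Tendsto (fun n => deriv θ (ξ n)) atTop (nhds 0) := by
    simp only [hξd]
    have := (htop.comp (tendsto_atTop_add_const_right _ 1 hn)).sub (htop.comp hn)
    rwa [sub_self] at this
  have hlim2 : Tendsto (fun n => f (θ (ξ n))) atTop (nhds (f 1)) :=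
    (hf.continuous.tendsto 1).comp (htop.comp hξtop)
  have hlim := (hlim1.pow 2).sub ((hlim2.sub_const (f 1)).const_mul 2)
  simp only [hconst _ z] at hlim
  have := tendsto_nhds_unique tendsto_const_nhds hlim
  norm_num at this
  linarith

theorem sqrt_le_mul_abs_sub_of_deriv_eq_zero {f : ℝ → ℝ} (hf : ContDiff ℝ 2 f) {a : ℝ}
    (ha : deriv f a = 0) {R : ℝ} (haR : a ∈ Set.Icc (-R) R) :
    ∃ K, 0 ≤ K ∧ ∀ u ∈ Set.Icc (-R) R, √(2 * (f u - f a)) ≤ K * |u - a| := by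
  obtain ⟨M, hM0, hM⟩ := abs_sub_le_mul_sq_of_deriv_eq_zero hf ha haR
  refine ⟨√(2 * M), sqrt_nonneg _, fun u hu => ?_⟩
  rw [← sqrt_sq_eq_abs, ← sqrt_mul (by positivity)]
  exact sqrt_le_sqrt (by linarith [(le_abs_self _).trans (hM u hu)])

theorem exists_abs_le_of_tendsto {θ : ℝ → ℝ} (hθ : Continuous θ) {a b : ℝ}
    (htop : Tendsto θ atTop (nhds a)) (hbot : Tendsto θ atBot (nhds b)) :
    ∃ R, ∀ z, |θ z| ≤ R := by
  obtain ⟨x, hx⟩ := eventually_atTop.1 (htop.abs.eventually_le_const (lt_add_one |a|))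
  obtain ⟨y, hy⟩ := eventually_atBot.1 (hbot.abs.eventually_le_const (lt_add_one |b|))
  obtain ⟨C, hC⟩ := (isCompact_Icc (a := y) (b := x)).exists_bound_of_continuousOn hθ.continuousOn
  refine ⟨max C (max (|a| + 1) (|b| + 1)), fun z => ?_⟩
  rcases le_total x z with h | h
  · exact (hx z h).trans ((le_max_left _ _).trans (le_max_right _ _))
  rcases le_total z y with h' | h'
  · exact (hy z h').trans ((le_max_right _ _).trans (le_max_right _ _))
  · exact (hC z ⟨h', h⟩).trans (le_max_left _ _)

theorem ne_of_isOptimalProfile {f θ : ℝ → ℝ} (hf : ContDiff ℝ 2 f) (hθ : IsOptimalProfile f θ)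
    {a : ℝ} (ha0 : a ≠ 0) (ha : deriv f a = 0) (hfa : f a = f 1) (z : ℝ) : θ z ≠ a := by
  obtain ⟨R, hR⟩ := exists_abs_le_of_tendsto hθ.1.continuous hθ.2.2.2.1 hθ.2.2.2.2
  have hmem : ∀ z, θ z ∈ Set.Icc (-max R |a|) (max R |a|) := fun z =>
    abs_le.1 ((hR z).trans (le_max_left _ _))
  obtain ⟨K, -, hK⟩ := sqrt_le_mul_abs_sub_of_deriv_eq_zero hf ha
    (R := max R |a|) (abs_le.1 (le_max_right _ _))
  refine sub_ne_zero.1 (ne_zero_of_abs_deriv_le_mul_abs (y := fun z => θ z - a) (y' := deriv θ)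
    (K := K)
    (fun z => (((hθ.1.differentiable (by norm_num)) z).hasDerivAt).sub_const a)
    (fun z => ?_) (by simpa [hθ.2.2.1] using ha0) z)
  rw [← sqrt_sq_eq_abs, deriv_sq_eq_of_isOptimalProfile hf hθ z, ← hfa]
  exact hK _ (hmem z)

theorem isOptimalProfile_first_order {f θ : ℝ → ℝ} (hf : ContDiff ℝ 2 f)
    (hf1 : deriv f 1 = 0) (hfm1 : deriv f (-1) = 0) (hwell : f (-1) = f 1)
    (hpos : ∀ u ∈ Set.Ioo (-1 : ℝ) 1, f 1 < f u) (hθ : IsOptimalProfile f θ) :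
    (∀ z, θ z ∈ Set.Ioo (-1 : ℝ) 1) ∧ ∀ z, HasDerivAt θ (√(2 * (f (θ z) - f 1))) z := by
  have hc : Continuous θ := hθ.1.continuous
  have hmem : ∀ z, θ z ∈ Set.Ioo (-1 : ℝ) 1 := fun z => by
    constructor
    · by_contra! h
      obtain ⟨y, hy⟩ := mem_range_of_exists_le_of_exists_ge hc ⟨z, h⟩
        ⟨0, by rw [hθ.2.2.1]; norm_num⟩
      exact ne_of_isOptimalProfile hf hθ (by norm_num) hfm1 hwell y hy
    · by_contra! h
      obtain ⟨y, hy⟩ := mem_range_of_exists_le_of_exists_ge hc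
        ⟨0, by rw [hθ.2.2.1]; norm_num⟩ ⟨z, h⟩
      exact ne_of_isOptimalProfile hf hθ (by norm_num) hf1 rfl y hy
  have hd : ∀ z, HasDerivAt θ (deriv θ z) z := fun z =>
    ((hθ.1.differentiable (by norm_num)) z).hasDerivAt
  have hsq := deriv_sq_eq_of_isOptimalProfile hf hθ
  have hne : ∀ z, deriv θ z ≠ 0 := fun z h => by
    have := hsq z
    rw [h] at this
    linarith [hpos _ (hmem z)]
  have hdc : Continuous (deriv θ) := hθ.1.continuous_deriv (by norm_num)
  have hdpos : ∀ z, 0 < deriv θ z := by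
    by_contra! h
    obtain ⟨z, hz⟩ := h
    have hneg : ∀ y, deriv θ y ≤ 0 := by
      by_contra! h'
      obtain ⟨y, hy⟩ := h'
      obtain ⟨x, hx⟩ := mem_range_of_exists_le_of_exists_ge hdc ⟨z, hz⟩ ⟨y, hy.le⟩
      exact hne x hx
    have hanti : Antitone θ := antitone_of_hasDerivAt_nonpos hd hneg
    have h1 := hanti.le_of_tendsto hθ.2.2.2.1 0
    rw [hθ.2.2.1] at h1
    linarith
  refine ⟨hmem, fun z => ?_⟩
  rw [← hsq z, sqrt_sq (hdpos z).le]
  exact hd z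

theorem contDiff_of_hasDerivAt_comp {g θ : ℝ → ℝ} (hd : ∀ z, HasDerivAt θ (g (θ z)) z)
    (hg : ∀ z, ContDiffAt ℝ (⊤ : ℕ∞) g (θ z)) : ContDiff ℝ (⊤ : ℕ∞) θ := by
  have hdiff : Differentiable ℝ θ := fun z => (hd z).differentiableAt
  refine contDiff_infty.2 fun n => ?_
  induction n with
  | zero => exact contDiff_zero.2 hdiff.continuous
  | succ n ih =>
    rw [Nat.cast_add, Nat.cast_one, contDiff_succ_iff_deriv]
    refine ⟨hdiff, by simp, ?_⟩
    rw [show deriv θ = g ∘ θ from funext fun z => (hd z).deriv]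
    exact contDiff_iff_contDiffAt.2 fun z =>
      ((hg z).of_le (by exact_mod_cast le_top)).comp z ih.contDiffAt

theorem eventually_mul_sq_le_of_lt_deriv_deriv {f : ℝ → ℝ} (hf : ContDiff ℝ 2 f) {a c : ℝ}
    (ha : deriv f a = 0) (hc : c < iteratedDeriv 2 f a) :
    ∀ᶠ u in nhds a, c * (u - a) ^ 2 ≤ 2 * (f u - f a) := by
  have hfd : ∀ u, HasDerivAt f (deriv f u) u := fun u =>
    ((hf.differentiable (by norm_num)) u).hasDerivAt
  have hf' : ContDiff ℝ 1 (deriv f) :=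
    ContDiff.deriv' (n := 1) (by simpa [one_add_one_eq_two] using hf)
  set φ : ℝ → ℝ := fun u => 2 * f u - c * (u - a) ^ 2 with hφ
  have hφ' : deriv φ = fun u => 2 * deriv f u - c * (2 * (u - a)) := funext fun u => by
    refine (((hfd u).const_mul 2).sub
      ((((hasDerivAt_id' u).sub_const a).pow 2).const_mul c)).deriv.trans ?_
    simp
  have hφ'' : deriv (deriv φ) a = 2 * iteratedDeriv 2 f a - 2 * c := by
    rw [hφ', iteratedDeriv_succ, iteratedDeriv_one]
    refine (((((hf'.differentiable (by norm_num)) a).hasDerivAt).const_mul 2).sub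
      ((((hasDerivAt_id' a).sub_const a).const_mul 2).const_mul c)).deriv.trans ?_
    ring
  have hmin : IsLocalMin φ a := isLocalMin_of_deriv_deriv_pos (by rw [hφ'']; linarith)
    (by simp [hφ', ha]) (by have := hf.continuous; fun_prop)
  filter_upwards [hmin] with u hu
  simp only [hφ, sub_self] at hu
  linarith

theorem iteratedDeriv_succ_eq_comp_or_eq_comp_mul_deriv {f θ : ℝ → ℝ}
    (hf : ContDiff ℝ (⊤ : ℕ∞) f) (hf1 : deriv f 1 = 0) (hfm1 : deriv f (-1) = 0)
    (hwell : f (-1) = f 1) (hd : ∀ z, HasDerivAt θ (deriv θ z) z)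
    (hdd : ∀ z, HasDerivAt (deriv θ) (deriv f (θ z)) z)
    (hsq : ∀ z, deriv θ z ^ 2 = 2 * (f (θ z) - f 1)) (k : ℕ) :
    ∃ ψ : ℝ → ℝ, ContDiff ℝ (⊤ : ℕ∞) ψ ∧
      ((ψ 1 = 0 ∧ ψ (-1) = 0 ∧ ∀ z, iteratedDeriv (k + 1) θ z = ψ (θ z)) ∨
        ∀ z, iteratedDeriv (k + 1) θ z = ψ (θ z) * deriv θ z) := by
  have hsmooth : ∀ {ψ : ℝ → ℝ}, ContDiff ℝ (⊤ : ℕ∞) ψ → ContDiff ℝ (⊤ : ℕ∞) (deriv ψ) :=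
    fun h => (contDiff_infty_iff_deriv.1 h).2
  induction k with
  | zero => exact ⟨fun _ => 1, contDiff_const, Or.inr fun z => by simp [iteratedDeriv_one]⟩
  | succ k ih =>
    obtain ⟨ψ, hψ, h⟩ := ih
    have hψθ : ∀ z, HasDerivAt (fun z => ψ (θ z)) (deriv ψ (θ z) * deriv θ z) z := fun z =>
      ((hψ.differentiable (by simp)) (θ z)).hasDerivAt.comp z (hd z)
    rcases h with ⟨-, -, h⟩ | h
    · refine ⟨deriv ψ, hsmooth hψ, Or.inr fun z => ?_⟩
      rw [iteratedDeriv_succ, funext h]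
      exact (hψθ z).deriv
    · refine ⟨fun u => deriv ψ u * (2 * (f u - f 1)) + ψ u * deriv f u, ?_,
        Or.inl ⟨by simp [hf1], by simp [hfm1, hwell], fun z => ?_⟩⟩
      · exact ((hsmooth hψ).mul (contDiff_const.mul (hf.sub contDiff_const))).add
          (hψ.mul (hsmooth hf))
      · rw [iteratedDeriv_succ, funext h]
        refine ((hψθ z).mul (hdd z)).deriv.trans ?_
        simp only [← hsq z]
        ring

theorem exists_abs_iteratedDeriv_succ_le {f θ : ℝ → ℝ}
    (hf : ContDiff ℝ (⊤ : ℕ∞) f) (hf1 : deriv f 1 = 0) (hfm1 : deriv f (-1) = 0)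
    (hwell : f (-1) = f 1) (hmem : ∀ z, θ z ∈ Set.Icc (-1 : ℝ) 1)
    (hd : ∀ z, HasDerivAt θ (deriv θ z) z)
    (hdd : ∀ z, HasDerivAt (deriv θ) (deriv f (θ z)) z)
    (hsq : ∀ z, deriv θ z ^ 2 = 2 * (f (θ z) - f 1)) {a : ℝ} (ha : a = 1 ∨ a = -1) (k : ℕ) :
    ∃ M, 0 ≤ M ∧ ∀ z, |iteratedDeriv (k + 1) θ z| ≤ M * |θ z - a| := by
  have haI : a ∈ Set.Icc (-1 : ℝ) 1 := by rcases ha with rfl | rfl <;> norm_num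
  have hfa : f a = f 1 := by rcases ha with rfl | rfl <;> simp [hwell]
  have hfa' : deriv f a = 0 := by rcases ha with rfl | rfl <;> assumption
  obtain ⟨ψ, hψ, h⟩ :=
    iteratedDeriv_succ_eq_comp_or_eq_comp_mul_deriv hf hf1 hfm1 hwell hd hdd hsq k
  rcases h with ⟨h1, hm1, h⟩ | h
  · have hψa : ψ a = 0 := by rcases ha with rfl | rfl <;> assumption
    obtain ⟨M, hM0, hM⟩ := abs_sub_le_mul_abs_sub_of_contDiff (hψ.of_le (by simp)) 1
    refine ⟨M, hM0, fun z => ?_⟩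
    have := hM _ (hmem z) a haI
    rwa [hψa, sub_zero, ← h] at this
  · obtain ⟨K, hK0, hK⟩ := sqrt_le_mul_abs_sub_of_deriv_eq_zero
      (contDiff_infty.1 hf 2) hfa' haI
    obtain ⟨B, hB⟩ := (isCompact_Icc (a := (-1 : ℝ)) (b := 1)).exists_bound_of_continuousOn
      hψ.continuous.continuousOn
    have hB0 : 0 ≤ B := (norm_nonneg _).trans (hB a haI)
    refine ⟨B * K, by positivity, fun z => ?_⟩
    rw [h, abs_mul, mul_assoc]
    refine mul_le_mul (hB _ (hmem z)) ?_ (abs_nonneg _) hB0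
    rw [← sqrt_sq_eq_abs, hsq z, ← hfa]
    exact hK _ (hmem z)

theorem exists_abs_iteratedDeriv_sub_const_le {f θ : ℝ → ℝ}
    (hf : ContDiff ℝ (⊤ : ℕ∞) f) (hf1 : deriv f 1 = 0) (hfm1 : deriv f (-1) = 0)
    (hwell : f (-1) = f 1) (hmem : ∀ z, θ z ∈ Set.Icc (-1 : ℝ) 1)
    (hd : ∀ z, HasDerivAt θ (deriv θ z) z)
    (hdd : ∀ z, HasDerivAt (deriv θ) (deriv f (θ z)) z)
    (hsq : ∀ z, deriv θ z ^ 2 = 2 * (f (θ z) - f 1)) {a : ℝ} (ha : a = 1 ∨ a = -1) (k : ℕ) :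
    ∃ M, 0 ≤ M ∧ ∀ z, |iteratedDeriv k (fun y => θ y - a) z| ≤ M * |θ z - a| := by
  cases k with
  | zero => exact ⟨1, zero_le_one, fun z => by simp⟩
  | succ k =>
    have hderiv : deriv (fun y => θ y - a) = deriv θ := funext fun z => ((hd z).sub_const a).deriv
    rw [iteratedDeriv_succ', hderiv, ← iteratedDeriv_succ']
    exact exists_abs_iteratedDeriv_succ_le hf hf1 hfm1 hwell hmem hd hdd hsq ha k

theorem eventually_mul_abs_sub_le_sqrt {f : ℝ → ℝ} (hf : ContDiff ℝ 2 f) {a α : ℝ}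
    (ha : deriv f a = 0) (hα : 0 < α) (hαa : α < √(iteratedDeriv 2 f a)) :
    ∀ᶠ u in nhds a, α * |u - a| ≤ √(2 * (f u - f a)) := by
  filter_upwards [eventually_mul_sq_le_of_lt_deriv_deriv hf ha ((lt_sqrt hα.le).1 hαa)] with u hu
  rw [← abs_of_pos hα, ← abs_mul]
  exact abs_le_sqrt (by rwa [mul_pow])

/-- Existence, uniqueness, smoothness, monotonicity and exponential decay
of the optimal profile for a double-well potential. -/
theorem optimal_profile_exists_unique (f : ℝ → ℝ) (hf : ContDiff ℝ (⊤ : ℕ∞) f)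
    (hf1 : deriv f 1 = 0) (hfm1 : deriv f (-1) = 0)
    (hf1'' : 0 < iteratedDeriv 2 f 1) (hfm1'' : 0 < iteratedDeriv 2 f (-1))
    (hW : ∀ u ∈ Set.Ioo (-1 : ℝ) 1,
      (∫ x in (-1 : ℝ)..u, deriv f x) = (∫ x in (1 : ℝ)..u, deriv f x) ∧
        0 < ∫ x in (-1 : ℝ)..u, deriv f x) :
    ∃ θ₀ : ℝ → ℝ, IsOptimalProfile f θ₀ ∧
      (∀ θ : ℝ → ℝ, IsOptimalProfile f θ → θ = θ₀) ∧
      ContDiff ℝ (⊤ : ℕ∞) θ₀ ∧ (∀ z : ℝ, 0 < deriv θ₀ z) ∧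
      ∀ k : ℕ, ∀ α : ℝ, 0 < α →
        α < min (Real.sqrt (iteratedDeriv 2 f 1)) (Real.sqrt (iteratedDeriv 2 f (-1))) →
        ∃ C : ℝ,
          (∀ z : ℝ, 0 ≤ z →
            |iteratedDeriv k (fun y => θ₀ y - 1) z| ≤ C * Real.exp (-α * |z|)) ∧
          (∀ z : ℝ, z ≤ 0 →
            |iteratedDeriv k (fun y => θ₀ y + 1) z| ≤ C * Real.exp (-α * |z|)) := by
  have hf2 : ContDiff ℝ 2 f := contDiff_infty.1 hf 2
  have hfd : ∀ u, HasDerivAt f (deriv f u) u := fun u =>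
    ((hf.differentiable (by simp)) u).hasDerivAt
  have hint : ∀ a b, (∫ x in a..b, deriv f x) = f b - f a := fun a b =>
    integral_eq_sub_of_hasDerivAt (fun x _ => hfd x)
      ((hf.continuous_deriv (by simp)).intervalIntegrable a b)
  simp only [hint] at hW
  have hwell : f (-1) = f 1 := by linarith [(hW 0 (by norm_num)).1]
  have hpos : ∀ u ∈ Set.Ioo (-1 : ℝ) 1, f 1 < f u := fun u hu => by
    linarith [(hW u hu).2]
  set g : ℝ → ℝ := fun u => √(2 * (f u - f 1)) with hg
  have hgpos : ∀ u ∈ Set.Ioo (-1 : ℝ) 1, 0 < g u := fun u hu =>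
    sqrt_pos.2 (by linarith [hpos u hu])
  obtain ⟨K₁, hK₁0, hK₁⟩ := sqrt_le_mul_abs_sub_of_deriv_eq_zero hf2 hf1 (R := 1) (by norm_num)
  obtain ⟨K₂, hK₂0, hK₂⟩ := sqrt_le_mul_abs_sub_of_deriv_eq_zero hf2 hfm1 (R := 1) (by norm_num)
  have hr : ∀ u ∈ Set.Ioo (-1 : ℝ) 1, g u ≤ (K₁ + K₂ + 1) * (1 - u) := fun u hu => by
    have h := hK₁ u (Set.Ioo_subset_Icc_self hu)
    rw [abs_sub_comm, abs_of_pos (sub_pos.2 hu.2)] at h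
    exact h.trans (mul_le_mul_of_nonneg_right (by linarith) (by linarith [hu.2]))
  have hl : ∀ u ∈ Set.Ioo (-1 : ℝ) 1, g u ≤ (K₁ + K₂ + 1) * (1 + u) := fun u hu => by
    have h := hK₂ u (Set.Ioo_subset_Icc_self hu)
    rw [hwell, sub_neg_eq_add, add_comm u, abs_of_pos (by linarith [hu.1])] at h
    exact h.trans (mul_le_mul_of_nonneg_right (by linarith) (by linarith [hu.1]))
  have hgc : Continuous g := by
    have := hf.continuous
    fun_prop
  obtain ⟨θ, hmem, hd, h0, htop, hbot, huniq⟩ :=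
    exists_unique_heteroclinic hgc hgpos (by positivity) hr hl
  have hθ : ContDiff ℝ (⊤ : ℕ∞) θ := contDiff_of_hasDerivAt_comp hd fun z =>
    (contDiffAt_const.mul (hf.contDiffAt.sub contDiffAt_const)).sqrt
      (by linarith [hpos _ (hmem z)])
  have hdg : ∀ z, deriv θ z = g (θ z) := fun z => (hd z).deriv
  have hd' : ∀ z, HasDerivAt θ (deriv θ z) z := fun z => by
    rw [hdg]
    exact hd z
  have hsq : ∀ z, deriv θ z ^ 2 = 2 * (f (θ z) - f 1) := fun z => by
    rw [hdg]
    exact sq_sqrt (by linarith [hpos _ (hmem z)])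
  have hdd : ∀ z, HasDerivAt (deriv θ) (deriv f (θ z)) z := fun z => by
    have hFpos : 0 < g (θ z) := hgpos _ (hmem z)
    rw [show deriv θ = fun z => √(2 * (f (θ z) - f 1)) from funext hdg]
    refine (((((hfd (θ z)).comp z (hd z)).sub_const (f 1)).const_mul 2).sqrt
      (by simp only [Function.comp_apply]; linarith [hpos _ (hmem z)])).congr_deriv ?_
    change 2 * (deriv f (θ z) * g (θ z)) / (2 * g (θ z)) = _
    field_simp
  have hprofile : IsOptimalProfile f θ := by
    refine ⟨contDiff_infty.1 hθ 2, fun z => ?_, h0, htop, hbot⟩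
    rw [iteratedDeriv_succ, iteratedDeriv_one, (hdd z).deriv, neg_add_cancel]
  refine ⟨θ, hprofile, fun w hw => ?_, hθ, fun z => ?_, fun k α hα hαmin => ?_⟩
  · obtain ⟨hw1, hw2⟩ := isOptimalProfile_first_order hf2 hf1 hfm1 hwell hpos hw
    exact huniq w hw1 hw2 hw.2.2.1
  · rw [hdg]
    exact hgpos _ (hmem z)
  have hmem' : ∀ z, θ z ∈ Set.Icc (-1 : ℝ) 1 := fun z => Set.Ioo_subset_Icc_self (hmem z)
  obtain ⟨M₁, hM₁0, hM₁⟩ := exists_abs_iteratedDeriv_sub_const_le hf hf1 hfm1 hwell hmem' hd' hdd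
    hsq (Or.inl rfl) k
  obtain ⟨M₂, hM₂0, hM₂⟩ := exists_abs_iteratedDeriv_sub_const_le hf hf1 hfm1 hwell hmem' hd' hdd
    hsq (Or.inr rfl) k
  simp only [sub_neg_eq_add] at hM₂
  have hright : ∀ z, |θ z - 1| = 1 - θ z := fun z => by
    rw [abs_sub_comm, abs_of_pos (sub_pos.2 (hmem z).2)]
  have hleft : ∀ z, |θ z + 1| = θ z + 1 := fun z => abs_of_pos (by linarith [(hmem z).1])
  obtain ⟨C₁, hC₁⟩ := exists_le_mul_exp_of_hasDerivAt_le (α := α)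
    (fun z => (hd z).const_sub 1) <| by
      filter_upwards [htop.eventually (eventually_mul_abs_sub_le_sqrt hf2 hf1 hα
        (hαmin.trans_le (min_le_left _ _)))] with z hz
      rw [hright] at hz
      linarith
  obtain ⟨C₂, hC₂⟩ := exists_le_mul_exp_of_hasDerivAt_le (α := α)
    (fun z => ((hd (-z)).comp z (hasDerivAt_neg z)).add_const 1) <| by
      filter_upwards [(hbot.comp tendsto_neg_atTop_atBot).eventually
        (eventually_mul_abs_sub_le_sqrt hf2 hfm1 hα
          (hαmin.trans_le (min_le_right _ _)))] with z hz
      simp only [Function.comp_apply, sub_neg_eq_add, hwell, hleft] at hz ⊢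
      linarith
  refine ⟨max (M₁ * C₁) (M₂ * C₂), fun z hz => ?_, fun z hz => ?_⟩
  · rw [abs_of_nonneg hz]
    refine (hM₁ z).trans (le_trans ?_
      (mul_le_mul_of_nonneg_right (le_max_left _ _) (exp_pos _).le))
    rw [hright, mul_assoc]
    exact mul_le_mul_of_nonneg_left (hC₁ z hz) hM₁0
  · rw [abs_of_nonpos hz]
    refine (hM₂ z).trans (le_trans ?_
      (mul_le_mul_of_nonneg_right (le_max_right _ _) (exp_pos _).le))
    rw [hleft, mul_assoc]
    have h := hC₂ (-z) (neg_nonneg.2 hz)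
    simp only [Function.comp_apply, neg_neg] at h
    exact mul_le_mul_of_nonneg_left h hM₂0
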